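/- Let A := MvPolynomial ℤ ℂ be the commutative polynomial algebra on generators X_n (n ∈ ℤ), let φ : ℤ → ℂ be an odd function (φ(−s) = −φ(s) for all s) with finite support, and let B : A → A → A be a ℂ-bilinear map such that (i) for every a ∈ A the map B(a, ·) is a derivation, i.e. B(a, y·z) = y·B(a, z) + z·B(a, y) for all y, z ∈ A, and (ii) B(X_n, X_m) = Σ_{s ∈ ℤ} φ(s) X_{n−s} X_{m+s} for all n, m ∈ ℤ. Then the Jacobi identity holds on generators: B(X_n, B(X_m, X_l)) + B(X_m, B(X_l, X_n)) + B(X_l, B(X_n, X_m)) = 0 for all n, m, l ∈ ℤ. -/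

import Mathlib

open MvPolynomial

/-- Two double sums weighted by `φ s * φ r`, with `φ` odd, cancel when their summands agree up to
swapping the indices and changing the sign of one of them. -/
theorem sum_odd_smul_add_sum_eq_zero {R M : Type*} [CommRing R] [AddCommGroup M] [Module R M]
    {φ : ℤ → R} (hodd : ∀ s, φ (-s) = -φ s) {S : Finset ℤ} (hS : ∀ s ∈ S, -s ∈ S)
    (G H : ℤ → ℤ → M) (hGH : ∀ s r, H (-s) r = G r s) :
    ∑ s ∈ S, ∑ r ∈ S, (φ s * φ r) • G s r + ∑ s ∈ S, ∑ r ∈ S, (φ s * φ r) • H s r = 0 := by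
  have hneg : ∑ s ∈ S, ∑ r ∈ S, (φ s * φ r) • H s r =
      ∑ s ∈ S, ∑ r ∈ S, (φ (-s) * φ r) • H (-s) r :=
    Finset.sum_nbij' (fun s => -s) (fun s => -s) hS hS (by simp) (by simp) (by simp)
  rw [hneg, Finset.sum_comm, ← Finset.sum_add_distrib]
  refine Finset.sum_eq_zero fun s _ => ?_
  rw [← Finset.sum_add_distrib]
  refine Finset.sum_eq_zero fun r _ => ?_
  rw [hGH, hodd, mul_comm (φ r), neg_mul, neg_smul, add_neg_cancel]

/-- The iterated bracket of three generators, expanded by the Leibniz rule. -/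
theorem quadratic_bracket_iterate {R : Type*} [CommRing R] {φ : ℤ → R} {S : Finset ℤ}
    {B : MvPolynomial ℤ R →ₗ[R] MvPolynomial ℤ R →ₗ[R] MvPolynomial ℤ R}
    (hder : ∀ a y z : MvPolynomial ℤ R, B a (y * z) = y * B a z + z * B a y)
    (hgen : ∀ n m : ℤ, B (X n) (X m) = ∑ s ∈ S, φ s • (X (n - s) * X (m + s))) (a b c : ℤ) :
    B (X a) (B (X b) (X c)) =
      ∑ s ∈ S, ∑ r ∈ S, (φ s * φ r) • (X (a - r) * X (b - s) * X (c + s + r)) +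
      ∑ s ∈ S, ∑ r ∈ S, (φ s * φ r) • (X (a - r) * X (b - s + r) * X (c + s)) := by
  rw [hgen b c, map_sum, ← Finset.sum_add_distrib]
  refine Finset.sum_congr rfl fun s _ => ?_
  rw [map_smul, hder, hgen, hgen, smul_add, Finset.mul_sum, Finset.mul_sum, Finset.smul_sum,
    Finset.smul_sum]
  congr 1 <;> refine Finset.sum_congr rfl fun r _ => ?_ <;>
    rw [mul_smul_comm, smul_smul] <;> congr 1 <;> ring

/-- Algebraic core of Proposition 2: any quadratic translation-invariant bracket
`B(X_n, X_m) = Σ_s φ(s) X_{n-s} X_{m+s}` on the polynomial algebra `ℂ[X_n : n ∈ ℤ]`,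
with odd finitely supported structure function `φ` and such that each `B(a, ·)` is a
derivation, satisfies the Jacobi identity on generators. -/
theorem quadratic_bracket_jacobi (φ : ℤ → ℂ) (hodd : ∀ s : ℤ, φ (-s) = -φ s)
    (hfin : (Function.support φ).Finite)
    (B : MvPolynomial ℤ ℂ →ₗ[ℂ] MvPolynomial ℤ ℂ →ₗ[ℂ] MvPolynomial ℤ ℂ)
    (hder : ∀ a y z : MvPolynomial ℤ ℂ, B a (y * z) = y * B a z + z * B a y)
    (hgen : ∀ n m : ℤ, B (X n) (X m) = ∑ᶠ s : ℤ, φ s • (X (n - s) * X (m + s)))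
    (n m l : ℤ) :
    B (X n) (B (X m) (X l)) + B (X m) (B (X l) (X n)) + B (X l) (B (X n) (X m)) = 0 := by
  have hS : ∀ s ∈ hfin.toFinset, -s ∈ hfin.toFinset := by
    simp [hodd]
  have hsum : ∀ n m : ℤ, B (X n) (X m) =
      ∑ s ∈ hfin.toFinset, φ s • (X (n - s) * X (m + s)) := fun n m => by
    rw [hgen]
    refine finsum_eq_sum_of_support_subset _ fun s hs => ?_
    rw [Set.Finite.coe_toFinset]
    exact Function.support_smul_subset_left _ _ hs
  simp only [quadratic_bracket_iterate hder hsum]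
  have hnm := sum_odd_smul_add_sum_eq_zero hodd hS
    (fun s r => (X (n - r) * X (m - s) * X (l + s + r) : MvPolynomial ℤ ℂ))
    (fun s r => X (m - r) * X (l - s + r) * X (n + s)) fun s r => by ring_nf
  have hml := sum_odd_smul_add_sum_eq_zero hodd hS
    (fun s r => (X (m - r) * X (l - s) * X (n + s + r) : MvPolynomial ℤ ℂ))
    (fun s r => X (l - r) * X (n - s + r) * X (m + s)) fun s r => by ring_nf
  have hln := sum_odd_smul_add_sum_eq_zero hodd hS
    (fun s r => (X (l - r) * X (n - s) * X (m + s + r) : MvPolynomial ℤ ℂ))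
    (fun s r => X (n - r) * X (m - s + r) * X (l + s)) fun s r => by ring_nf
  linear_combination hnm + hml + hln
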